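/- arXiv:2502.21149 — 6 statements merged into one kernel-verified Lean document; each statement's English description precedes it below -/
import Mathlib

section
/- Let (X,T) be a nonautonomous dynamical system, Z ⊂ X_0, and f = (f_k) an equicontinuous sequence of continuous real-valued potentials. Then the Bowen topological pressure is bounded above by the packing topological pressure: P^B(T,f,Z) ≤ P^P(T,f,Z). In particular, with f = 0, h^B(T,Z) ≤ h^P(T,Z). -/
open Filter MeasureTheory Set
open scoped ENNReal Topology

namespace NDS

variable {X : ℕ → Type*}

/-- Iterates `T^j : X 0 → X j` of a nonautonomous dynamical system `T`. -/
def iter (T : ∀ k, X k → X (k + 1)) : ∀ j, X 0 → X j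
  | 0 => fun x => x
  | j + 1 => fun x => T j (iter T j x)

/-- The Birkhoff-type sum `S_n^T f (x) = ∑_{j<n} f_j (T^j x)`. -/
def birk (T : ∀ k, X k → X (k + 1)) (f : ∀ k, X k → ℝ) (n : ℕ) (x : X 0) : ℝ :=
  ∑ j ∈ Finset.range n, f j (iter T j x)

/-- The uniform norm `‖f‖ = sup_k sup_x |f_k x|` of a sequence of potentials. -/
noncomputable def fnorm (f : ∀ k, X k → ℝ) : ℝ :=
  ⨆ k : ℕ, ⨆ x : X k, |f k x|

/-- `log : ℝ≥0∞ → EReal` with the conventions `log 0 = -∞`, `log ∞ = ∞`. -/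
noncomputable def elog (x : ℝ≥0∞) : EReal :=
  if x = 0 then ⊥ else if x = ⊤ then ⊤ else ((Real.log x.toReal : ℝ) : EReal)

/-- The nonnegative part of an extended real, as an element of `ℝ≥0∞`. -/
noncomputable def toENN (x : EReal) : ℝ≥0∞ :=
  if x = ⊤ then ⊤ else ENNReal.ofReal x.toReal

/-- The canonical map `ℝ≥0∞ → EReal`. -/
noncomputable def ofENN (x : ℝ≥0∞) : EReal :=
  if x = ⊤ then ⊤ else ((x.toReal : ℝ) : EReal)

/-- The integral of an extended-real-valued function: the difference of the lower
integrals of its positive and negative parts. -/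
noncomputable def eInt {α : Type*} [MeasurableSpace α] (μ : Measure α) (g : α → EReal) : EReal :=
  ofENN (∫⁻ x, toENN (g x) ∂μ) - ofENN (∫⁻ x, toENN (-g x) ∂μ)

section Metric

variable [∀ k, MetricSpace (X k)]

/-- The open Bowen ball `B_n^T(x,ε)`. -/
def bowenBall (T : ∀ k, X k → X (k + 1)) (n : ℕ) (ε : ℝ) (x : X 0) : Set (X 0) :=
  {y | ∀ j < n, dist (iter T j x) (iter T j y) < ε}

/-- The closed Bowen ball `B̄_n^T(x,ε)`. -/
def bowenClosedBall (T : ∀ k, X k → X (k + 1)) (n : ℕ) (ε : ℝ) (x : X 0) : Set (X 0) :=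
  {y | ∀ j < n, dist (iter T j x) (iter T j y) ≤ ε}

/-- Equicontinuity of a sequence of potentials `f = (f_k)`. -/
def EquicontPotential (f : ∀ k, X k → ℝ) : Prop :=
  ∀ ε : ℝ, 0 < ε → ∃ δ : ℝ, 0 < δ ∧ ∀ k, ∀ x y : X k, dist x y < δ → |f k x - f k y| < ε

/-- The supremum of the Birkhoff sum `S_n^T f` over a subset `A` of `X 0`. -/
noncomputable def supBirk (T : ∀ k, X k → X (k + 1)) (f : ∀ k, X k → ℝ) (n : ℕ)
    (A : Set (X 0)) : ℝ :=
  ⨆ y : A, birk T f n (y : X 0)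

/-- Measure-theoretic lower local pressure `P̲_μ(T,f,x)`. -/
noncomputable def localLowerPres [MeasurableSpace (X 0)] (μ : Measure (X 0))
    (T : ∀ k, X k → X (k + 1)) (f : ∀ k, X k → ℝ) (x : X 0) : EReal :=
  ⨆ (ε : ℝ) (_ : 0 < ε),
    liminf (fun n : ℕ =>
      (((n : ℝ)⁻¹ : ℝ) : EReal) *
        (-(elog (μ (bowenBall T n ε x))) + ((birk T f n x : ℝ) : EReal))) atTop

/-- Measure-theoretic upper local pressure `P̄_μ(T,f,x)`. -/
noncomputable def localUpperPres [MeasurableSpace (X 0)] (μ : Measure (X 0))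
    (T : ∀ k, X k → X (k + 1)) (f : ∀ k, X k → ℝ) (x : X 0) : EReal :=
  ⨆ (ε : ℝ) (_ : 0 < ε),
    limsup (fun n : ℕ =>
      (((n : ℝ)⁻¹ : ℝ) : EReal) *
        (-(elog (μ (bowenBall T n ε x))) + ((birk T f n x : ℝ) : EReal))) atTop

/-- Measure-theoretic lower local entropy `h̲_μ(T,x)`. -/
noncomputable def localLowerEnt [MeasurableSpace (X 0)] (μ : Measure (X 0))
    (T : ∀ k, X k → X (k + 1)) (x : X 0) : EReal :=
  ⨆ (ε : ℝ) (_ : 0 < ε),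
    liminf (fun n : ℕ =>
      (((n : ℝ)⁻¹ : ℝ) : EReal) * (-(elog (μ (bowenBall T n ε x))))) atTop

/-- Measure-theoretic upper local entropy `h̄_μ(T,x)`. -/
noncomputable def localUpperEnt [MeasurableSpace (X 0)] (μ : Measure (X 0))
    (T : ∀ k, X k → X (k + 1)) (x : X 0) : EReal :=
  ⨆ (ε : ℝ) (_ : 0 < ε),
    limsup (fun n : ℕ =>
      (((n : ℝ)⁻¹ : ℝ) : EReal) * (-(elog (μ (bowenBall T n ε x))))) atTop

/-- Measure-theoretic lower pressure `P̲_μ(T,f) = ∫ P̲_μ(T,f,x) dμ(x)`. -/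
noncomputable def lowerPres [MeasurableSpace (X 0)] (μ : Measure (X 0))
    (T : ∀ k, X k → X (k + 1)) (f : ∀ k, X k → ℝ) : EReal :=
  eInt μ (fun x => localLowerPres μ T f x)

/-- Measure-theoretic upper pressure `P̄_μ(T,f) = ∫ P̄_μ(T,f,x) dμ(x)`. -/
noncomputable def upperPres [MeasurableSpace (X 0)] (μ : Measure (X 0))
    (T : ∀ k, X k → X (k + 1)) (f : ∀ k, X k → ℝ) : EReal :=
  eInt μ (fun x => localUpperPres μ T f x)

/-- Measure-theoretic lower entropy `h̲_μ(T) = ∫ h̲_μ(T,x) dμ(x)`. -/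
noncomputable def lowerEnt [MeasurableSpace (X 0)] (μ : Measure (X 0))
    (T : ∀ k, X k → X (k + 1)) : EReal :=
  eInt μ (fun x => localLowerEnt μ T x)

/-- Measure-theoretic upper entropy `h̄_μ(T) = ∫ h̄_μ(T,x) dμ(x)`. -/
noncomputable def upperEnt [MeasurableSpace (X 0)] (μ : Measure (X 0))
    (T : ∀ k, X k → X (k + 1)) : EReal :=
  eInt μ (fun x => localUpperEnt μ T x)

/-- The Bowen premeasure `M^s_{N,ε}(T,f,Z)`: the infimum of
`∑ exp(-n_i s + S_{n_i}^T f(x_i))` over all countable `(N,ε)`-covers of `Z` by open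
Bowen balls `B_{n_i}^T(x_i,ε)` with `n_i ≥ N`. -/
noncomputable def bowenPre (T : ∀ k, X k → X (k + 1)) (f : ∀ k, X k → ℝ)
    (s : ℝ) (N : ℕ) (ε : ℝ) (Z : Set (X 0)) : ℝ≥0∞ :=
  ⨅ (D : Set (X 0 × ℕ)) (_ : D.Countable) (_ : ∀ p ∈ D, N ≤ p.2)
      (_ : Z ⊆ ⋃ p ∈ D, bowenBall T p.2 ε p.1),
    ∑' p : D, ENNReal.ofReal (Real.exp (-(p.1.2 : ℝ) * s + birk T f p.1.2 p.1.1))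

/-- `M^s_ε(T,f,Z) = lim_{N→∞} M^s_{N,ε}(T,f,Z)` (an increasing limit). -/
noncomputable def bowenPreLim (T : ∀ k, X k → X (k + 1)) (f : ∀ k, X k → ℝ)
    (s : ℝ) (ε : ℝ) (Z : Set (X 0)) : ℝ≥0∞ :=
  ⨆ N : ℕ, bowenPre T f s N ε Z

/-- The critical value `P^B(T,f,Z,ε) = inf {s : M^s_ε(T,f,Z) = 0}`. -/
noncomputable def bowenCrit (T : ∀ k, X k → X (k + 1)) (f : ∀ k, X k → ℝ)
    (ε : ℝ) (Z : Set (X 0)) : EReal :=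
  ⨅ (s : ℝ) (_ : bowenPreLim T f s ε Z = 0), (s : EReal)

/-- The Bowen (Pesin–Pitskel') topological pressure
`P^B(T,f,Z) = lim_{ε→0} P^B(T,f,Z,ε)` (an increasing limit as `ε ↓ 0`). -/
noncomputable def bowenP (T : ∀ k, X k → X (k + 1)) (f : ∀ k, X k → ℝ)
    (Z : Set (X 0)) : EReal :=
  ⨆ (ε : ℝ) (_ : 0 < ε), bowenCrit T f ε Z

/-- The Bowen topological entropy `h^B(T,Z) = P^B(T,0,Z)`. -/
noncomputable def bowenEnt (T : ∀ k, X k → X (k + 1)) (Z : Set (X 0)) : EReal :=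
  bowenP T (fun k => fun _ : X k => (0 : ℝ)) Z

/-- The premeasure `N^s_{N,ε}(T,f,Z)` using suprema of Birkhoff sums over the balls. -/
noncomputable def nBowenPre (T : ∀ k, X k → X (k + 1)) (f : ∀ k, X k → ℝ)
    (s : ℝ) (N : ℕ) (ε : ℝ) (Z : Set (X 0)) : ℝ≥0∞ :=
  ⨅ (D : Set (X 0 × ℕ)) (_ : D.Countable) (_ : ∀ p ∈ D, N ≤ p.2)
      (_ : Z ⊆ ⋃ p ∈ D, bowenBall T p.2 ε p.1),
    ∑' p : D, ENNReal.ofReal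
      (Real.exp (-(p.1.2 : ℝ) * s + supBirk T f p.1.2 (bowenBall T p.1.2 ε p.1.1)))

/-- `N^s_ε(T,f,Z) = lim_{N→∞} N^s_{N,ε}(T,f,Z)`. -/
noncomputable def nBowenPreLim (T : ∀ k, X k → X (k + 1)) (f : ∀ k, X k → ℝ)
    (s : ℝ) (ε : ℝ) (Z : Set (X 0)) : ℝ≥0∞ :=
  ⨆ N : ℕ, nBowenPre T f s N ε Z

/-- The critical value `Q^B(T,f,Z,ε) = inf {s : N^s_ε(T,f,Z) = 0}`. -/
noncomputable def nBowenCrit (T : ∀ k, X k → X (k + 1)) (f : ∀ k, X k → ℝ)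
    (ε : ℝ) (Z : Set (X 0)) : EReal :=
  ⨅ (s : ℝ) (_ : nBowenPreLim T f s ε Z = 0), (s : EReal)

/-- The weighted Bowen premeasure `W^s_{N,ε}(T,f,g)`: the infimum of
`∑ c_i exp(-n_i s + sup_{B_{n_i}^T(x_i,ε)} S_{n_i}^T f)` over all countable families
`{(B_{n_i}^T(x_i,ε), c_i)}` with `0 < c_i`, `n_i ≥ N` and `∑ c_i χ_{B_i} ≥ g`. -/
noncomputable def wBowenPre (T : ∀ k, X k → X (k + 1)) (f : ∀ k, X k → ℝ)
    (s : ℝ) (N : ℕ) (ε : ℝ) (g : X 0 → ℝ) : ℝ≥0∞ :=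
  ⨅ (D : Set ((X 0 × ℕ) × ℝ)) (_ : D.Countable)
      (_ : ∀ p ∈ D, N ≤ p.1.2 ∧ 0 < p.2)
      (_ : ∀ x : X 0, ENNReal.ofReal (g x) ≤
        ∑' p : D, (bowenBall T p.1.1.2 ε p.1.1.1).indicator
          (fun _ => ENNReal.ofReal p.1.2) x),
    ∑' p : D, ENNReal.ofReal p.1.2 *
      ENNReal.ofReal
        (Real.exp (-(p.1.1.2 : ℝ) * s + supBirk T f p.1.1.2 (bowenBall T p.1.1.2 ε p.1.1.1)))

/-- `D` is a countable `(N,ε)`-packing of `Z`: the closed Bowen balls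
`B̄_{n}^T(x,ε)`, `(x,n) ∈ D`, are pairwise disjoint with centers in `Z` and orders `≥ N`. -/
def IsPacking (T : ∀ k, X k → X (k + 1)) (N : ℕ) (ε : ℝ) (Z : Set (X 0))
    (D : Set (X 0 × ℕ)) : Prop :=
  D.Countable ∧ (∀ p ∈ D, p.1 ∈ Z ∧ N ≤ p.2) ∧
    ∀ p ∈ D, ∀ q ∈ D, p ≠ q →
      Disjoint (bowenClosedBall T p.2 ε p.1) (bowenClosedBall T q.2 ε q.1)

/-- The packing premeasure `P^s_{N,ε}(T,f,Z)`: the supremum of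
`∑ exp(-n_i s + S_{n_i}^T f(x_i))` over all countable `(N,ε)`-packings of `Z`. -/
noncomputable def packPre (T : ∀ k, X k → X (k + 1)) (f : ∀ k, X k → ℝ)
    (s : ℝ) (N : ℕ) (ε : ℝ) (Z : Set (X 0)) : ℝ≥0∞ :=
  ⨆ (D : Set (X 0 × ℕ)) (_ : IsPacking T N ε Z D),
    ∑' p : D, ENNReal.ofReal (Real.exp (-(p.1.2 : ℝ) * s + birk T f p.1.2 p.1.1))

/-- `P^s_{∞,ε}(T,f,Z) = lim_{N→∞} P^s_{N,ε}(T,f,Z)` (a decreasing limit). -/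
noncomputable def packPreInf (T : ∀ k, X k → X (k + 1)) (f : ∀ k, X k → ℝ)
    (s : ℝ) (ε : ℝ) (Z : Set (X 0)) : ℝ≥0∞ :=
  ⨅ N : ℕ, packPre T f s N ε Z

/-- The packing measure-like quantity
`P^s_ε(T,f,Z) = inf { ∑_i P^s_{∞,ε}(T,f,Z_i) : Z ⊆ ⋃_i Z_i }`. -/
noncomputable def packMeasure (T : ∀ k, X k → X (k + 1)) (f : ∀ k, X k → ℝ)
    (s : ℝ) (ε : ℝ) (Z : Set (X 0)) : ℝ≥0∞ :=
  ⨅ (Zs : ℕ → Set (X 0)) (_ : Z ⊆ ⋃ i, Zs i), ∑' i, packPreInf T f s ε (Zs i)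

/-- The critical value `P^P(T,f,Z,ε) = inf {s : P^s_ε(T,f,Z) = 0}`. -/
noncomputable def packCrit (T : ∀ k, X k → X (k + 1)) (f : ∀ k, X k → ℝ)
    (ε : ℝ) (Z : Set (X 0)) : EReal :=
  ⨅ (s : ℝ) (_ : packMeasure T f s ε Z = 0), (s : EReal)

/-- The packing topological pressure `P^P(T,f,Z) = lim_{ε→0} P^P(T,f,Z,ε)`. -/
noncomputable def packP (T : ∀ k, X k → X (k + 1)) (f : ∀ k, X k → ℝ)
    (Z : Set (X 0)) : EReal :=
  ⨆ (ε : ℝ) (_ : 0 < ε), packCrit T f ε Z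

/-- The packing topological entropy `h^P(T,Z) = P^P(T,0,Z)`. -/
noncomputable def packEnt (T : ∀ k, X k → X (k + 1)) (Z : Set (X 0)) : EReal :=
  packP T (fun k => fun _ : X k => (0 : ℝ)) Z

/-- The packing premeasure `Q^s_{N,ε}(T,f,Z)` using suprema of Birkhoff sums over the balls. -/
noncomputable def qPackPre (T : ∀ k, X k → X (k + 1)) (f : ∀ k, X k → ℝ)
    (s : ℝ) (N : ℕ) (ε : ℝ) (Z : Set (X 0)) : ℝ≥0∞ :=
  ⨆ (D : Set (X 0 × ℕ)) (_ : IsPacking T N ε Z D),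
    ∑' p : D, ENNReal.ofReal
      (Real.exp (-(p.1.2 : ℝ) * s + supBirk T f p.1.2 (bowenClosedBall T p.1.2 ε p.1.1)))

/-- `Q^s_{∞,ε}(T,f,Z) = lim_{N→∞} Q^s_{N,ε}(T,f,Z)`. -/
noncomputable def qPackPreInf (T : ∀ k, X k → X (k + 1)) (f : ∀ k, X k → ℝ)
    (s : ℝ) (ε : ℝ) (Z : Set (X 0)) : ℝ≥0∞ :=
  ⨅ N : ℕ, qPackPre T f s N ε Z

/-- `Q^s_ε(T,f,Z) = inf { ∑_i Q^s_{∞,ε}(T,f,Z_i) : Z ⊆ ⋃_i Z_i }`. -/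
noncomputable def qPackMeasure (T : ∀ k, X k → X (k + 1)) (f : ∀ k, X k → ℝ)
    (s : ℝ) (ε : ℝ) (Z : Set (X 0)) : ℝ≥0∞ :=
  ⨅ (Zs : ℕ → Set (X 0)) (_ : Z ⊆ ⋃ i, Zs i), ∑' i, qPackPreInf T f s ε (Zs i)

/-- The critical value `Q^P(T,f,Z,ε) = inf {s : Q^s_ε(T,f,Z) = 0}`. -/
noncomputable def qPackCrit (T : ∀ k, X k → X (k + 1)) (f : ∀ k, X k → ℝ)
    (ε : ℝ) (Z : Set (X 0)) : EReal :=
  ⨅ (s : ℝ) (_ : qPackMeasure T f s ε Z = 0), (s : EReal)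

end Metric

/-- The distance function of an explicitly given metric space structure. -/
def mdist {α : Type*} (m : MetricSpace α) (x y : α) : ℝ :=
  @dist α m.toPseudoMetricSpace.toDist x y

end NDS

namespace NDS

variable {X : ℕ → Type*} [∀ k, MetricSpace (X k)]

lemma continuous_iter {T : ∀ k, X k → X (k + 1)} (hT : ∀ k, Continuous (T k)) :
    ∀ j, Continuous (iter T j)
  | 0 => continuous_id
  | j + 1 => (hT j).comp (continuous_iter hT j)

lemma isOpen_bowenBall {T : ∀ k, X k → X (k + 1)} (hT : ∀ k, Continuous (T k))
    (n : ℕ) (ε : ℝ) (x : X 0) : IsOpen (bowenBall T n ε x) := by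
  have h : bowenBall T n ε x =
      ⋂ j ∈ Finset.range n, {y | dist (iter T j x) (iter T j y) < ε} := by
    ext y
    simp [bowenBall]
  rw [h]
  exact isOpen_biInter_finset fun j _ =>
    isOpen_lt (continuous_const.dist (continuous_iter hT j)) continuous_const

lemma bowenBall_subset_bowenClosedBall (T : ∀ k, X k → X (k + 1)) (n : ℕ) (ε : ℝ) (x : X 0) :
    bowenBall T n ε x ⊆ bowenClosedBall T n ε x :=
  fun _ hy j hj => (hy j hj).le

lemma mem_bowenBall_self (T : ∀ k, X k → X (k + 1)) (n : ℕ) {ε : ℝ} (hε : 0 < ε) (x : X 0) :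
    x ∈ bowenBall T n ε x :=
  fun j _ => by simpa using hε

lemma bowenPre_mono_order (T : ∀ k, X k → X (k + 1)) (f : ∀ k, X k → ℝ) (s ε : ℝ) {M N : ℕ}
    (h : M ≤ N) (Z : Set (X 0)) : bowenPre T f s M ε Z ≤ bowenPre T f s N ε Z :=
  le_iInf fun D => le_iInf fun hc => le_iInf fun hN => le_iInf fun hZ =>
    iInf₂_le_of_le D hc <| iInf₂_le_of_le (fun p hp => h.trans (hN p hp)) hZ le_rfl

/-- Antitonicity of the packing premeasure in the minimal order. -/
lemma packPre_anti_order (T : ∀ k, X k → X (k + 1)) (f : ∀ k, X k → ℝ) (s ε : ℝ) {M N : ℕ}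
    (h : M ≤ N) (Z : Set (X 0)) : packPre T f s N ε Z ≤ packPre T f s M ε Z :=
  iSup₂_le fun D hD => le_iSup₂_of_le D
    ⟨hD.1, fun p hp => ⟨(hD.2.1 p hp).1, h.trans (hD.2.1 p hp).2⟩, hD.2.2⟩ le_rfl

/-- Null sets of a Bowen premeasure are stable under countable unions. -/
lemma bowenPre_eq_zero_of_subset_iUnion {T : ∀ k, X k → X (k + 1)} {f : ∀ k, X k → ℝ} {s : ℝ}
    {N : ℕ} {ε : ℝ} {Z : Set (X 0)} {Zs : ℕ → Set (X 0)} (hZ : Z ⊆ ⋃ i, Zs i)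
    (h : ∀ i, bowenPre T f s N ε (Zs i) = 0) : bowenPre T f s N ε Z = 0 := by
  refine le_antisymm (le_of_forall_gt fun η hη => ?_) zero_le
  obtain ⟨η', hη', hsum⟩ := ENNReal.exists_pos_sum_of_countable' hη.ne' ℕ
  have key : ∀ i, ∃ D : Set (X 0 × ℕ), D.Countable ∧ (∀ p ∈ D, N ≤ p.2) ∧
      (Zs i ⊆ ⋃ p ∈ D, bowenBall T p.2 ε p.1) ∧
      ∑' p : D, ENNReal.ofReal (Real.exp (-(p.1.2 : ℝ) * s + birk T f p.1.2 p.1.1)) < η' i := by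
    intro i
    have hi : bowenPre T f s N ε (Zs i) < η' i := (h i).trans_lt (hη' i)
    simp only [bowenPre, iInf_lt_iff] at hi
    obtain ⟨D, hc, hN, hD, hlt⟩ := hi
    exact ⟨D, hc, hN, hD, hlt⟩
  choose D hc hN hD hlt using key
  have hcover : Z ⊆ ⋃ p ∈ ⋃ i, D i, bowenBall T p.2 ε p.1 := by
    intro x hx
    obtain ⟨i, hi⟩ := mem_iUnion.1 (hZ hx)
    obtain ⟨p, hp, hxp⟩ := mem_iUnion₂.1 (hD i hi)
    exact mem_iUnion₂.2 ⟨p, mem_iUnion.2 ⟨i, hp⟩, hxp⟩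
  have hord : ∀ p ∈ ⋃ i, D i, N ≤ p.2 := fun p hp => by
    obtain ⟨i, hi⟩ := mem_iUnion.1 hp
    exact hN i p hi
  calc bowenPre T f s N ε Z
      ≤ ∑' p : ⋃ i, D i,
          ENNReal.ofReal (Real.exp (-(p.1.2 : ℝ) * s + birk T f p.1.2 p.1.1)) :=
        iInf₂_le_of_le _ (countable_iUnion hc) <| iInf₂_le_of_le hord hcover le_rfl
    _ ≤ ∑' i, ∑' p : D i,
          ENNReal.ofReal (Real.exp (-(p.1.2 : ℝ) * s + birk T f p.1.2 p.1.1)) :=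
        ENNReal.tsum_iUnion_le_tsum
          (fun p : X 0 × ℕ => ENNReal.ofReal (Real.exp (-(p.2 : ℝ) * s + birk T f p.2 p.1))) D
    _ ≤ ∑' i, η' i := ENNReal.tsum_le_tsum fun i => (hlt i).le
    _ < η := hsum

/-- A maximal disjoint family of closed Bowen balls of order `n` and radius `ε` becomes a cover
when the radius is tripled, so packings control covers up to the change of exponent. -/
lemma bowenPre_le_mul_packPre [CompactSpace (X 0)] {T : ∀ k, X k → X (k + 1)}
    (hT : ∀ k, Continuous (T k)) (f : ∀ k, X k → ℝ) (s t : ℝ) (n : ℕ) {ε : ℝ} (hε : 0 < ε)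
    (Z : Set (X 0)) :
    bowenPre T f t n (3 * ε) Z ≤
      ENNReal.ofReal (Real.exp (-(n : ℝ) * (t - s))) * packPre T f s n ε Z := by
  have hself : ∀ x, x ∈ bowenClosedBall T n ε x := fun x =>
    bowenBall_subset_bowenClosedBall T n ε x (mem_bowenBall_self T n hε x)
  obtain ⟨u, huZ, hdisj, hmeet⟩ := Vitali.exists_disjoint_subfamily_covering_enlargement
    (bowenClosedBall T n ε) Z (fun _ => (1 : ℝ)) 2 one_lt_two (fun _ _ => zero_le_one) 1
    (fun _ _ => le_rfl) (fun x _ => ⟨x, hself x⟩)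
  have hu : u.Countable :=
    (hdisj.mono fun x => bowenBall_subset_bowenClosedBall T n ε x).countable_of_isOpen
      (fun x _ => isOpen_bowenBall hT n ε x) fun x _ => ⟨x, mem_bowenBall_self T n hε x⟩
  set D : Set (X 0 × ℕ) := (fun x => (x, n)) '' u with hDdef
  have hord : ∀ p ∈ D, p.2 = n := by
    rintro _ ⟨x, _, rfl⟩
    rfl
  have hpack : IsPacking T n ε Z D := by
    refine ⟨hu.image _, ?_, ?_⟩
    · rintro _ ⟨x, hx, rfl⟩
      exact ⟨huZ hx, le_rfl⟩
    · rintro _ ⟨x, hx, rfl⟩ _ ⟨y, hy, rfl⟩ hxy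
      exact hdisj hx hy fun h => hxy (by rw [h])
  have hcover : Z ⊆ ⋃ p ∈ D, bowenBall T p.2 (3 * ε) p.1 := by
    intro z hz
    obtain ⟨x, hx, ⟨w, hwz, hwx⟩, -⟩ := hmeet z hz
    refine mem_iUnion₂.2 ⟨(x, n), ⟨x, hx, rfl⟩, fun j hj => ?_⟩
    calc dist (iter T j x) (iter T j z)
        ≤ dist (iter T j x) (iter T j w) + dist (iter T j z) (iter T j w) :=
          dist_triangle_right _ _ _
      _ ≤ ε + ε := add_le_add (hwx j hj) (hwz j hj)
      _ < 3 * ε := by linarith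
  calc bowenPre T f t n (3 * ε) Z
      ≤ ∑' p : D, ENNReal.ofReal (Real.exp (-(p.1.2 : ℝ) * t + birk T f p.1.2 p.1.1)) :=
        iInf₂_le_of_le D hpack.1 <|
          iInf₂_le_of_le (fun p hp => (hpack.2.1 p hp).2) hcover le_rfl
    _ = ENNReal.ofReal (Real.exp (-(n : ℝ) * (t - s))) *
          ∑' p : D, ENNReal.ofReal (Real.exp (-(p.1.2 : ℝ) * s + birk T f p.1.2 p.1.1)) := by
        rw [← ENNReal.tsum_mul_left]
        refine tsum_congr fun p => ?_
        rw [← ENNReal.ofReal_mul (Real.exp_pos _).le, ← Real.exp_add, hord p.1 p.2]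
        congr 2
        ring
    _ ≤ _ := by
        gcongr
        exact le_iSup₂_of_le D hpack le_rfl

/-- A finite packing premeasure limit forces the Bowen premeasures at any larger exponent
to vanish. -/
lemma bowenPre_eq_zero_of_packPreInf_ne_top [CompactSpace (X 0)] {T : ∀ k, X k → X (k + 1)}
    (hT : ∀ k, Continuous (T k)) {f : ∀ k, X k → ℝ} {s t : ℝ} (hst : s < t) {ε : ℝ}
    (hε : 0 < ε) {Z : Set (X 0)} (h : packPreInf T f s ε Z ≠ ⊤) (N : ℕ) :
    bowenPre T f t N (3 * ε) Z = 0 := by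
  obtain ⟨M, hM⟩ := iInf_lt_iff.1 h.lt_top
  have hlim : Tendsto (fun n : ℕ =>
      ENNReal.ofReal (Real.exp (-(n : ℝ) * (t - s))) * packPre T f s M ε Z) atTop (𝓝 0) := by
    have hexp : Tendsto (fun n : ℕ => Real.exp (-(n : ℝ) * (t - s))) atTop (𝓝 0) := by
      refine Real.tendsto_exp_atBot.comp ?_
      exact (tendsto_neg_atTop_atBot.comp tendsto_natCast_atTop_atTop).atBot_mul_const
        (sub_pos.2 hst)
    simpa using ENNReal.Tendsto.mul_const (ENNReal.tendsto_ofReal hexp) (Or.inr hM.ne)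
  refine le_antisymm (ge_of_tendsto hlim ?_) zero_le
  filter_upwards [eventually_ge_atTop N, eventually_ge_atTop M] with n hN hM
  calc bowenPre T f t N (3 * ε) Z
      ≤ bowenPre T f t n (3 * ε) Z := bowenPre_mono_order T f t _ hN Z
    _ ≤ _ := bowenPre_le_mul_packPre hT f s t n hε Z
    _ ≤ _ := by
        gcongr
        exact packPre_anti_order T f s ε hM Z

lemma bowenCrit_le_packCrit [CompactSpace (X 0)] {T : ∀ k, X k → X (k + 1)}
    (hT : ∀ k, Continuous (T k)) (f : ∀ k, X k → ℝ) {ε : ℝ} (hε : 0 < ε) (Z : Set (X 0)) :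
    bowenCrit T f (3 * ε) Z ≤ packCrit T f ε Z := by
  refine le_iInf₂ fun s hs => EReal.le_of_forall_lt_iff_le.1 fun t hst => ?_
  have hlt : packMeasure T f s ε Z < 1 := hs.trans_lt zero_lt_one
  simp only [packMeasure, iInf_lt_iff] at hlt
  obtain ⟨Zs, hZ, hsum⟩ := hlt
  have hfin : ∀ i, packPreInf T f s ε (Zs i) ≠ ⊤ :=
    ENNReal.ne_top_of_tsum_ne_top (hsum.trans ENNReal.one_lt_top).ne
  refine iInf₂_le t (ENNReal.iSup_eq_zero.2 fun N => ?_)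
  exact bowenPre_eq_zero_of_subset_iUnion hZ fun i =>
    bowenPre_eq_zero_of_packPreInf_ne_top hT (EReal.coe_lt_coe_iff.1 hst) hε (hfin i) N

lemma bowenP_le_packP [CompactSpace (X 0)] {T : ∀ k, X k → X (k + 1)}
    (hT : ∀ k, Continuous (T k)) (f : ∀ k, X k → ℝ) (Z : Set (X 0)) :
    bowenP T f Z ≤ packP T f Z := by
  refine iSup₂_le fun ε hε => le_iSup₂_of_le (ε / 3) (by positivity) ?_
  have h := bowenCrit_le_packCrit hT f (show 0 < ε / 3 by positivity) Z
  rwa [mul_div_cancel₀ ε three_ne_zero] at h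

end NDS

open NDS in
/-- Bowen pressure is dominated by packing pressure.
If `f` is equicontinuous then `P^B(T,f,Z) ≤ P^P(T,f,Z)`; in particular (`f = 0`),
`h^B(T,Z) ≤ h^P(T,Z)`. -/
theorem stmt12 {X : ℕ → Type*} [∀ k, MetricSpace (X k)] [∀ k, CompactSpace (X k)]
    (T : ∀ k, X k → X (k + 1)) (hT : ∀ k, Continuous (T k))
    (f : ∀ k, X k → ℝ) (hf : ∀ k, Continuous (f k)) (hfe : EquicontPotential f)
    (Z : Set (X 0)) :
    bowenP T f Z ≤ packP T f Z ∧ bowenEnt T Z ≤ packEnt T Z := by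
  exact ⟨bowenP_le_packP hT f Z, bowenP_le_packP hT _ Z⟩
end

section
/- Let (X,T) and (Y,R) be nonautonomous dynamical systems, g = (g_k) an equicontinuous sequence of continuous real-valued potentials on Y, and Z ⊂ X_0. (1) If π = (π_k) is an equisemiconjugacy from (X,T) to (Y,R), then P^B(T, π*g, Z) ≥ P^B(R, g, π_0(Z)) and P^P(T, π*g, Z) ≥ P^P(R, g, π_0(Z)); in particular h^B(T,Z) ≥ h^B(R,π_0(Z)) and h^P(T,Z) ≥ h^P(R,π_0(Z)). (2) If π is an equiconjugacy, then these inequalities are equalities. -/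
open Filter MeasureTheory Set
open scoped ENNReal Topology

namespace NDS

section Factor

variable {X Y : ℕ → Type*} {T : ∀ k, X k → X (k + 1)} {R : ∀ k, Y k → Y (k + 1)}
  {f : ∀ k, X k → ℝ} {g : ∀ k, Y k → ℝ} {π : ∀ k, X k → Y k}

theorem iter_map (hcomm : ∀ k x, R k (π k x) = π (k + 1) (T k x)) (j : ℕ) (x : X 0) :
    iter R j (π 0 x) = π j (iter T j x) := by
  induction j with
  | zero => rfl
  | succ j ih => simp only [iter, ih, hcomm]

theorem birk_map (hcomm : ∀ k x, R k (π k x) = π (k + 1) (T k x))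
    (hfg : ∀ k x, g k (π k x) = f k x) (n : ℕ) (x : X 0) :
    birk R g n (π 0 x) = birk T f n x :=
  Finset.sum_congr rfl fun j _ => by rw [iter_map hcomm, hfg]

variable [∀ k, MetricSpace (X k)] [∀ k, MetricSpace (Y k)]

theorem bowenPre_image_le (hcomm : ∀ k x, R k (π k x) = π (k + 1) (T k x))
    (hfg : ∀ k x, g k (π k x) = f k x) {ε δ : ℝ}
    (hδ : ∀ k (x y : X k), dist x y < δ → dist (π k x) (π k y) < ε)
    (s : ℝ) (N : ℕ) (Z : Set (X 0)) :
    bowenPre R g s N ε (π 0 '' Z) ≤ bowenPre T f s N δ Z := by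
  refine le_iInf₂ fun D hD => le_iInf₂ fun hN hZ => ?_
  let F : X 0 × ℕ → Y 0 × ℕ := fun p => (π 0 p.1, p.2)
  refine (iInf₂_le (F '' D) (hD.image F)).trans ((iInf₂_le ?_ ?_).trans ?_)
  · rintro _ ⟨p, hp, rfl⟩
    exact hN p hp
  · rintro _ ⟨z, hz, rfl⟩
    obtain ⟨p, hp, hzp⟩ := mem_iUnion₂.1 (hZ hz)
    refine mem_iUnion₂.2 ⟨F p, mem_image_of_mem F hp, fun j hj => ?_⟩
    rw [iter_map hcomm, iter_map hcomm]
    exact hδ j _ _ (hzp j hj)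
  · choose φ hφD hφ using fun q : F '' D => q.2
    have hinj : Function.Injective fun q => (⟨φ q, hφD q⟩ : D) := fun a b hab =>
      Subtype.ext (by rw [← hφ a, ← hφ b, Subtype.mk.inj hab])
    refine le_trans (le_of_eq (tsum_congr fun q => ?_))
      (ENNReal.tsum_comp_le_tsum_of_injective hinj _)
    rw [← hφ q, ← birk_map hcomm hfg]

theorem bowenP_image_le (hcomm : ∀ k x, R k (π k x) = π (k + 1) (T k x))
    (hfg : ∀ k x, g k (π k x) = f k x)
    (hπe : ∀ ε : ℝ, 0 < ε → ∃ δ : ℝ, 0 < δ ∧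
      ∀ k (x y : X k), dist x y < δ → dist (π k x) (π k y) < ε) (Z : Set (X 0)) :
    bowenP R g (π 0 '' Z) ≤ bowenP T f Z := by
  refine iSup₂_le fun ε hε => ?_
  obtain ⟨δ, hδ0, hδ⟩ := hπe ε hε
  refine le_trans (le_iInf₂ fun s hs => iInf₂_le (f := fun (s : ℝ)
      (_ : bowenPreLim R g s ε (π 0 '' Z) = 0) => (s : EReal)) s (le_antisymm ?_ bot_le))
    (le_iSup₂ (f := fun (ε : ℝ) (_ : 0 < ε) => bowenCrit T f ε Z) δ hδ0)
  exact (iSup_mono fun N => bowenPre_image_le hcomm hfg hδ s N Z).trans hs.le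

theorem packPre_image_le (hcomm : ∀ k x, R k (π k x) = π (k + 1) (T k x))
    (hfg : ∀ k x, g k (π k x) = f k x) {ε δ : ℝ}
    (hδ : ∀ k (x y : X k), dist x y ≤ δ → dist (π k x) (π k y) ≤ ε)
    (s : ℝ) (N : ℕ) (Z : Set (X 0)) :
    packPre R g s N ε (π 0 '' Z) ≤ packPre T f s N δ Z := by
  refine iSup₂_le fun D hD => ?_
  obtain ⟨hDc, hDm, hDd⟩ := hD
  choose c hcZ hc using fun q : D => (hDm q q.2).1
  let φ : D → X 0 × ℕ := fun q => (c q, q.1.2)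
  have hinj : Function.Injective φ := fun a b hab =>
    Subtype.ext (Prod.ext (by rw [← hc a, ← hc b, (Prod.mk.inj hab).1]) (Prod.mk.inj hab).2)
  have hmaps (q : D) {z : X 0} (hz : z ∈ bowenClosedBall T q.1.2 δ (c q)) :
      π 0 z ∈ bowenClosedBall R q.1.2 ε q.1.1 := fun j hj => by
    rw [← hc q, iter_map hcomm, iter_map hcomm]
    exact hδ j _ _ (hz j hj)
  have hpack : IsPacking T N δ Z (range φ) := by
    have := hDc.to_subtype
    refine ⟨countable_range φ, ?_, ?_⟩
    · rintro _ ⟨q, rfl⟩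
      exact ⟨hcZ q, (hDm q q.2).2⟩
    · rintro _ ⟨a, rfl⟩ _ ⟨b, rfl⟩ hab
      refine disjoint_left.2 fun z hza hzb => ?_
      refine disjoint_left.1 (hDd a a.2 b b.2 fun h => hab ?_) (hmaps a hza) (hmaps b hzb)
      rw [Subtype.ext h]
  refine le_trans ?_ (le_iSup₂ (range φ) hpack)
  refine le_trans (le_of_eq (tsum_congr fun q => ?_))
    (ENNReal.tsum_comp_le_tsum_of_injective (rangeFactorization_injective.2 hinj) _)
  rw [← hc q, birk_map hcomm hfg]
  rfl

theorem packP_image_le (hcomm : ∀ k x, R k (π k x) = π (k + 1) (T k x))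
    (hfg : ∀ k x, g k (π k x) = f k x)
    (hπe : ∀ ε : ℝ, 0 < ε → ∃ δ : ℝ, 0 < δ ∧
      ∀ k (x y : X k), dist x y < δ → dist (π k x) (π k y) < ε) (Z : Set (X 0)) :
    packP R g (π 0 '' Z) ≤ packP T f Z := by
  refine iSup₂_le fun ε hε => ?_
  obtain ⟨δ, hδ0, hδ⟩ := hπe ε hε
  have hδ' : ∀ k (x y : X k), dist x y ≤ δ / 2 → dist (π k x) (π k y) ≤ ε :=
    fun k x y h => (hδ k x y (h.trans_lt (half_lt_self hδ0))).le
  refine le_trans (le_iInf₂ fun s hs => iInf₂_le (f := fun (s : ℝ)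
      (_ : packMeasure R g s ε (π 0 '' Z) = 0) => (s : EReal)) s (le_antisymm ?_ bot_le))
    (le_iSup₂ (f := fun (ε : ℝ) (_ : 0 < ε) => packCrit T f ε Z) (δ / 2) (half_pos hδ0))
  refine le_trans (le_iInf₂ fun Zs hZs => ?_) hs.le
  refine (iInf₂_le (fun i => π 0 '' Zs i) ?_).trans
    (ENNReal.tsum_le_tsum fun i => iInf_mono fun N => packPre_image_le hcomm hfg hδ' s N (Zs i))
  rw [← image_iUnion]
  exact image_mono hZs

end Factor

end NDS

open NDS in
/-- Invariance of topological pressures and entropies under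
equi(semi)conjugacies.  Let `π` be an equisemiconjugacy from `(X,T)` to `(Y,R)`
and `g` an equicontinuous sequence of potentials on `Y`.  Then
`P^B(T,π*g,Z) ≥ P^B(R,g,π₀(Z))`, `P^P(T,π*g,Z) ≥ P^P(R,g,π₀(Z))`, and, for
entropies, `h^B(T,Z) ≥ h^B(R,π₀(Z))`, `h^P(T,Z) ≥ h^P(R,π₀(Z))`.  If moreover `π`
is an equiconjugacy (each `π_k` bijective with equicontinuous inverses), all these
inequalities are equalities. -/
theorem stmt14 {X Y : ℕ → Type*}
    [∀ k, MetricSpace (X k)] [∀ k, CompactSpace (X k)]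
    [∀ k, MetricSpace (Y k)] [∀ k, CompactSpace (Y k)]
    (T : ∀ k, X k → X (k + 1)) (hT : ∀ k, Continuous (T k))
    (R : ∀ k, Y k → Y (k + 1)) (hR : ∀ k, Continuous (R k))
    (g : ∀ k, Y k → ℝ) (hg : ∀ k, Continuous (g k)) (hge : EquicontPotential g)
    (π : ∀ k, X k → Y k) (hπc : ∀ k, Continuous (π k))
    (hπs : ∀ k, Function.Surjective (π k))
    (hcomm : ∀ k (x : X k), R k (π k x) = π (k + 1) (T k x))
    (hπe : ∀ ε : ℝ, 0 < ε → ∃ δ : ℝ, 0 < δ ∧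
      ∀ k (x y : X k), dist x y < δ → dist (π k x) (π k y) < ε)
    (Z : Set (X 0)) :
    (bowenP R g (π 0 '' Z) ≤ bowenP T (fun k => g k ∘ π k) Z ∧
      packP R g (π 0 '' Z) ≤ packP T (fun k => g k ∘ π k) Z ∧
      bowenEnt R (π 0 '' Z) ≤ bowenEnt T Z ∧
      packEnt R (π 0 '' Z) ≤ packEnt T Z) ∧
    ((∀ k, Function.Bijective (π k)) →
      (∀ ε : ℝ, 0 < ε → ∃ δ : ℝ, 0 < δ ∧
        ∀ k (x y : X k), dist (π k x) (π k y) < δ → dist x y < ε) →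
      (bowenP R g (π 0 '' Z) = bowenP T (fun k => g k ∘ π k) Z ∧
        packP R g (π 0 '' Z) = packP T (fun k => g k ∘ π k) Z ∧
        bowenEnt R (π 0 '' Z) = bowenEnt T Z ∧
        packEnt R (π 0 '' Z) = packEnt T Z)) := by
  refine ⟨⟨bowenP_image_le hcomm (fun _ _ => rfl) hπe Z,
    packP_image_le hcomm (fun _ _ => rfl) hπe Z,
    bowenP_image_le hcomm (fun _ _ => rfl) hπe Z,
    packP_image_le hcomm (fun _ _ => rfl) hπe Z⟩, fun hbij hinv => ?_⟩
  let σ : ∀ k, Y k → X k := fun k => (Equiv.ofBijective (π k) (hbij k)).symm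
  have hσπ : ∀ k x, σ k (π k x) = x := fun k =>
    (Equiv.ofBijective (π k) (hbij k)).symm_apply_apply
  have hπσ : ∀ k y, π k (σ k y) = y := fun k =>
    (Equiv.ofBijective (π k) (hbij k)).apply_symm_apply
  have hσcomm : ∀ k y, T k (σ k y) = σ (k + 1) (R k y) := fun k y => by
    rw [← hσπ (k + 1) (T k (σ k y)), ← hcomm, hπσ]
  have hσe : ∀ ε : ℝ, 0 < ε → ∃ δ : ℝ, 0 < δ ∧
      ∀ k (x y : Y k), dist x y < δ → dist (σ k x) (σ k y) < ε := fun ε hε => by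
    obtain ⟨δ, hδ0, hδ⟩ := hinv ε hε
    exact ⟨δ, hδ0, fun k x y h => hδ k _ _ (by rwa [hπσ, hπσ])⟩
  have hgσ : ∀ k y, (g k ∘ π k) (σ k y) = g k y := fun k y => congrArg (g k) (hπσ k y)
  have hZ : σ 0 '' (π 0 '' Z) = Z := by
    rw [image_image]
    simp only [hσπ, image_id']
  refine ⟨le_antisymm (bowenP_image_le hcomm (fun _ _ => rfl) hπe Z) ?_,
    le_antisymm (packP_image_le hcomm (fun _ _ => rfl) hπe Z) ?_,
    le_antisymm (bowenP_image_le hcomm (fun _ _ => rfl) hπe Z) ?_,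
    le_antisymm (packP_image_le hcomm (fun _ _ => rfl) hπe Z) ?_⟩
  · simpa only [hZ] using
      bowenP_image_le (f := g) (g := fun k => g k ∘ π k) hσcomm hgσ hσe (π 0 '' Z)
  · simpa only [hZ] using
      packP_image_le (f := g) (g := fun k => g k ∘ π k) hσcomm hgσ hσe (π 0 '' Z)
  · simpa only [hZ, bowenEnt] using bowenP_image_le (f := fun _ _ => 0) (g := fun _ _ => 0)
      hσcomm (fun _ _ => rfl) hσe (π 0 '' Z)
  · simpa only [hZ, packEnt] using packP_image_le (f := fun _ _ => 0) (g := fun _ _ => 0)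
      hσcomm (fun _ _ => rfl) hσe (π 0 '' Z)
end

section
/- Let (X,T) be a nonautonomous dynamical system in which each X_k carries two metrics d_k and d′_k inducing the same topology, and suppose the metric sequences d = (d_k) and d′ = (d′_k) are uniformly equivalent. Then for every equicontinuous sequence f = (f_k) of continuous real-valued potentials and every Z ⊂ X_0, the Bowen and packing pressures computed with d and with d′ coincide: P^B_d(T,f,Z) = P^B_{d′}(T,f,Z) and P^P_d(T,f,Z) = P^P_{d′}(T,f,Z); in particular h^B_d(T,Z) = h^B_{d′}(T,Z) and h^P_d(T,Z) = h^P_{d′}(T,Z). -/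
open Filter MeasureTheory Set
open scoped ENNReal Topology

namespace NDS

section Comparison

variable {X : ℕ → Type*}

theorem bowenCrit_le_of_bowenBall_subset (d d' : ∀ k, MetricSpace (X k))
    (T : ∀ k, X k → X (k + 1)) (f : ∀ k, X k → ℝ) (Z : Set (X 0)) {ε δ : ℝ}
    (h : ∀ n x, @bowenBall X d' T n δ x ⊆ @bowenBall X d T n ε x) :
    @bowenCrit X d T f ε Z ≤ @bowenCrit X d' T f δ Z := by
  have hpre : ∀ s N, @bowenPre X d T f s N ε Z ≤ @bowenPre X d' T f s N δ Z := by
    intro s N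
    refine le_iInf fun D => le_iInf fun hD => le_iInf fun hN => le_iInf fun hZ => ?_
    exact iInf_le_of_le D <| iInf_le_of_le hD <| iInf_le_of_le hN <|
      iInf_le_of_le (hZ.trans (iUnion₂_mono fun p _ => h p.2 p.1)) le_rfl
  refine le_iInf fun s => le_iInf fun hs => iInf_le_of_le s (iInf_le_of_le ?_ le_rfl)
  exact le_antisymm ((iSup_mono fun N => hpre s N).trans hs.le) zero_le

theorem packCrit_le_of_bowenClosedBall_subset (d d' : ∀ k, MetricSpace (X k))
    (T : ∀ k, X k → X (k + 1)) (f : ∀ k, X k → ℝ) (Z : Set (X 0)) {ε δ : ℝ}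
    (h : ∀ n x, @bowenClosedBall X d' T n δ x ⊆ @bowenClosedBall X d T n ε x) :
    @packCrit X d T f ε Z ≤ @packCrit X d' T f δ Z := by
  have hpre : ∀ s N Y, @packPre X d T f s N ε Y ≤ @packPre X d' T f s N δ Y := by
    intro s N Y
    refine iSup_le fun D => iSup_le fun hD => le_iSup_of_le D (le_iSup_of_le ?_ le_rfl)
    exact ⟨hD.1, hD.2.1, fun p hp q hq hpq =>
      (hD.2.2 p hp q hq hpq).mono (h p.2 p.1) (h q.2 q.1)⟩
  refine le_iInf fun s => le_iInf fun hs => iInf_le_of_le s (iInf_le_of_le ?_ le_rfl)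
  refine le_antisymm (le_trans ?_ hs.le) zero_le
  exact iInf_mono fun Zs => iInf_mono fun _ => ENNReal.tsum_le_tsum fun i =>
    iInf_mono fun N => hpre s N (Zs i)

theorem bowenP_le_of_uniform (d d' : ∀ k, MetricSpace (X k))
    (h : ∀ ε : ℝ, 0 < ε → ∃ δ : ℝ, 0 < δ ∧
      ∀ k (x y : X k), mdist (d' k) x y < δ → mdist (d k) x y < ε)
    (T : ∀ k, X k → X (k + 1)) (f : ∀ k, X k → ℝ) (Z : Set (X 0)) :
    @bowenP X d T f Z ≤ @bowenP X d' T f Z := by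
  refine iSup_le fun ε => iSup_le fun hε => ?_
  obtain ⟨δ, hδ, H⟩ := h ε hε
  exact le_iSup_of_le δ <| le_iSup_of_le hδ <|
    bowenCrit_le_of_bowenBall_subset d d' T f Z fun n x y hy j hj => H j _ _ (hy j hj)

theorem packP_le_of_uniform (d d' : ∀ k, MetricSpace (X k))
    (h : ∀ ε : ℝ, 0 < ε → ∃ δ : ℝ, 0 < δ ∧
      ∀ k (x y : X k), mdist (d' k) x y < δ → mdist (d k) x y < ε)
    (T : ∀ k, X k → X (k + 1)) (f : ∀ k, X k → ℝ) (Z : Set (X 0)) :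
    @packP X d T f Z ≤ @packP X d' T f Z := by
  refine iSup_le fun ε => iSup_le fun hε => ?_
  obtain ⟨δ, hδ, H⟩ := h ε hε
  exact le_iSup_of_le (δ / 2) <| le_iSup_of_le (half_pos hδ) <|
    packCrit_le_of_bowenClosedBall_subset d d' T f Z fun n x y hy j hj =>
      (H j _ _ ((hy j hj).trans_lt (half_lt_self hδ))).le

end Comparison

end NDS

open NDS in
/-- Topological pressures are metric irrelevant for uniformly
equivalent metrics.  If `d` and `d'` are sequences of metrics on the spaces `X k`
inducing the same topologies, and `d`, `d'` are uniformly equivalent, then for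
every equicontinuous sequence of potentials `f` and every `Z ⊆ X 0`, the Bowen and
packing pressures (and in particular the entropies) computed with `d` and with
`d'` coincide. -/
theorem stmt15 {X : ℕ → Type*} (d d' : ∀ k, MetricSpace (X k))
    (htopo : ∀ k,
      (d k).toPseudoMetricSpace.toUniformSpace.toTopologicalSpace =
        (d' k).toPseudoMetricSpace.toUniformSpace.toTopologicalSpace)
    (hcomp : ∀ k,
      @CompactSpace (X k) (d k).toPseudoMetricSpace.toUniformSpace.toTopologicalSpace)
    (T : ∀ k, X k → X (k + 1))
    (hT : ∀ k, @Continuous (X k) (X (k + 1))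
      (d k).toPseudoMetricSpace.toUniformSpace.toTopologicalSpace
      (d (k + 1)).toPseudoMetricSpace.toUniformSpace.toTopologicalSpace (T k))
    (hunif : ∀ ε : ℝ, 0 < ε → ∃ δ : ℝ, 0 < δ ∧
      ∀ k (x y : X k), mdist (d k) x y < δ → mdist (d' k) x y < ε)
    (hunif' : ∀ ε : ℝ, 0 < ε → ∃ δ : ℝ, 0 < δ ∧
      ∀ k (x y : X k), mdist (d' k) x y < δ → mdist (d k) x y < ε)
    (f : ∀ k, X k → ℝ)
    (hf : ∀ k, @Continuous (X k) ℝ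
      (d k).toPseudoMetricSpace.toUniformSpace.toTopologicalSpace _ (f k))
    (hfe : ∀ ε : ℝ, 0 < ε → ∃ δ : ℝ, 0 < δ ∧
      ∀ k (x y : X k), mdist (d k) x y < δ → |f k x - f k y| < ε)
    (Z : Set (X 0)) :
    @bowenP X d T f Z = @bowenP X d' T f Z ∧
    @packP X d T f Z = @packP X d' T f Z ∧
    @bowenEnt X d T Z = @bowenEnt X d' T Z ∧
    @packEnt X d T Z = @packEnt X d' T Z := by
  have hB : ∀ g : ∀ k, X k → ℝ, @bowenP X d T g Z = @bowenP X d' T g Z := fun g =>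
    (bowenP_le_of_uniform d d' hunif' T g Z).antisymm (bowenP_le_of_uniform d' d hunif T g Z)
  have hP : ∀ g : ∀ k, X k → ℝ, @packP X d T g Z = @packP X d' T g Z := fun g =>
    (packP_le_of_uniform d d' hunif' T g Z).antisymm (packP_le_of_uniform d' d hunif T g Z)
  exact ⟨hB f, hP f, hB _, hP _⟩
end

section
/- Let π = (π_k) be a semiconjugacy from the nonautonomous dynamical system (X,T) to (Y,R), let μ be a Borel probability measure on X_0, and let ν = (π_0)_* μ be the pushforward of μ under π_0. (1) If π is an equisemiconjugacy, then h̲_μ(T) ≥ h̲_ν(R) and h̄_μ(T) ≥ h̄_ν(R). (2) If π is an equiconjugacy, then h̲_μ(T) = h̲_ν(R) and h̄_μ(T) = h̄_ν(R). -/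
open Filter MeasureTheory Set
open scoped ENNReal Topology

namespace NDS

theorem elog_mono : Monotone elog := by
  intro a b hab
  by_cases ha : a = 0
  · simp [elog, ha]
  by_cases hb : b = ⊤
  · simp [elog, hb]
  have ha' : a ≠ ⊤ := ne_top_of_le_ne_top hb hab
  have hb' : b ≠ 0 := fun h => ha (le_antisymm (h ▸ hab) zero_le)
  simp only [elog, ha, hb, ha', hb', if_false]
  exact EReal.coe_le_coe_iff.2
    (Real.log_le_log (ENNReal.toReal_pos ha ha') (ENNReal.toReal_mono hb hab))

theorem elog_nonpos {a : ℝ≥0∞} (ha : a ≤ 1) : elog a ≤ 0 := by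
  simpa [elog] using elog_mono ha

theorem ofENN_mono : Monotone ofENN := by
  intro a b hab
  by_cases hb : b = ⊤
  · simp [ofENN, hb]
  simp only [ofENN, hb, ne_top_of_le_ne_top hb hab, if_false]
  exact EReal.coe_le_coe_iff.2 (ENNReal.toReal_mono hb hab)

theorem toENN_mono_of_nonneg {a b : EReal} (ha : 0 ≤ a) (hab : a ≤ b) : toENN a ≤ toENN b := by
  by_cases hb : b = ⊤
  · simp [toENN, hb]
  simp only [toENN, hb, ne_top_of_le_ne_top hb hab, if_false]
  exact ENNReal.ofReal_le_ofReal
    (EReal.toReal_le_toReal hab (ne_bot_of_le_ne_bot EReal.zero_ne_bot ha) hb)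

theorem toENN_neg_of_nonneg {a : EReal} (ha : 0 ≤ a) : toENN (-a) = 0 := by
  have h : -a ≤ 0 := by simpa using EReal.neg_le_neg_iff.2 ha
  have h_top : -a ≠ ⊤ := ne_top_of_le_ne_top EReal.zero_ne_top h
  simp only [toENN, h_top, if_false]
  exact ENNReal.ofReal_of_nonpos (EReal.toReal_nonpos h)

theorem eInt_of_nonneg {α : Type*} [MeasurableSpace α] (μ : Measure α) {g : α → EReal}
    (hg : ∀ x, 0 ≤ g x) : eInt μ g = ofENN (∫⁻ x, toENN (g x) ∂μ) := by
  simp [eInt, toENN_neg_of_nonneg (hg _), ofENN]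

theorem eInt_map_le {α β : Type*} [MeasurableSpace α] [MeasurableSpace β] {μ : Measure α}
    {p : α → β} {g : α → EReal} {h : β → EReal} (h_nonneg : ∀ y, 0 ≤ h y)
    (hle : ∀ x, h (p x) ≤ g x) : eInt (μ.map p) h ≤ eInt μ g := by
  rw [eInt_of_nonneg _ h_nonneg, eInt_of_nonneg _ fun x => (h_nonneg _).trans (hle x)]
  exact ofENN_mono ((lintegral_map_le _ _).trans
    (lintegral_mono fun x => toENN_mono_of_nonneg (h_nonneg _) (hle x)))

theorem iter_semiconj {X Y : ℕ → Type*} {T : ∀ k, X k → X (k + 1)}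
    {R : ∀ k, Y k → Y (k + 1)} {p : ∀ k, X k → Y k} (hcomm : ∀ k (x : X k), R k (p k x) = p (k + 1) (T k x))
    (j : ℕ) (x : X 0) : iter R j (p 0 x) = p j (iter T j x) := by
  induction j with
  | zero => rfl
  | succ j ih => simp only [iter, ih, hcomm]

section LocalEntropy

variable {X Y : ℕ → Type*} [∀ k, MetricSpace (X k)] [∀ k, MetricSpace (Y k)]
  [MeasurableSpace (X 0)] [MeasurableSpace (Y 0)]

theorem localEntRate_nonneg (μ : Measure (X 0)) [IsProbabilityMeasure μ]
    (T : ∀ k, X k → X (k + 1)) (n : ℕ) (ε : ℝ) (x : X 0) :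
    0 ≤ (((n : ℝ)⁻¹ : ℝ) : EReal) * (-(elog (μ (bowenBall T n ε x)))) :=
  mul_nonneg (EReal.coe_nonneg.2 (by positivity)) (EReal.neg_nonneg.2 (elog_nonpos prob_le_one))

theorem localLowerEnt_nonneg (μ : Measure (X 0)) [IsProbabilityMeasure μ]
    (T : ∀ k, X k → X (k + 1)) (x : X 0) : 0 ≤ localLowerEnt μ T x :=
  le_iSup₂_of_le 1 one_pos
    (le_liminf_of_le (by isBoundedDefault) (.of_forall fun n => localEntRate_nonneg μ T n 1 x))

theorem localLowerEnt_le_localUpperEnt (μ : Measure (X 0)) (T : ∀ k, X k → X (k + 1)) (x : X 0) :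
    localLowerEnt μ T x ≤ localUpperEnt μ T x :=
  iSup₂_mono fun _ _ => liminf_le_limsup

/-- If `p` sends `δ`-close points to `ε`-close points, then local entropy rates at scale `ε` of
the pushforward are bounded by those at scale `δ`. -/
theorem localEntRate_map_le {T : ∀ k, X k → X (k + 1)} {R : ∀ k, Y k → Y (k + 1)}
    {p : ∀ k, X k → Y k} (hp : Measurable (p 0))
    (hcomm : ∀ k (x : X k), R k (p k x) = p (k + 1) (T k x)) (μ : Measure (X 0)) {ε δ : ℝ}
    (hδ : ∀ k (x y : X k), dist x y < δ → dist (p k x) (p k y) < ε) (n : ℕ) (x : X 0) :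
    (((n : ℝ)⁻¹ : ℝ) : EReal) * (-(elog (μ.map (p 0) (bowenBall R n ε (p 0 x))))) ≤
      (((n : ℝ)⁻¹ : ℝ) : EReal) * (-(elog (μ (bowenBall T n δ x)))) := by
  have hsub : bowenBall T n δ x ⊆ p 0 ⁻¹' bowenBall R n ε (p 0 x) := fun y hy j hj => by
    rw [iter_semiconj hcomm, iter_semiconj hcomm]
    exact hδ _ _ _ (hy j hj)
  refine mul_le_mul_of_nonneg_left ?_ (EReal.coe_nonneg.2 (by positivity))
  exact EReal.neg_le_neg_iff.2
    (elog_mono ((measure_mono hsub).trans (Measure.le_map_apply hp.aemeasurable _)))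

theorem entropy_map_le {T : ∀ k, X k → X (k + 1)} {R : ∀ k, Y k → Y (k + 1)}
    {p : ∀ k, X k → Y k} (hp : Measurable (p 0))
    (hcomm : ∀ k (x : X k), R k (p k x) = p (k + 1) (T k x))
    (μ : Measure (X 0)) [IsProbabilityMeasure μ]
    (hequi : ∀ ε : ℝ, 0 < ε → ∃ δ : ℝ, 0 < δ ∧
      ∀ k (x y : X k), dist x y < δ → dist (p k x) (p k y) < ε) :
    lowerEnt (μ.map (p 0)) R ≤ lowerEnt μ T ∧ upperEnt (μ.map (p 0)) R ≤ upperEnt μ T := by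
  have : IsProbabilityMeasure (μ.map (p 0)) := Measure.isProbabilityMeasure_map hp.aemeasurable
  have h_nonneg := localLowerEnt_nonneg (μ.map (p 0)) R
  constructor
  · refine eInt_map_le h_nonneg fun x => iSup₂_le fun ε hε => ?_
    obtain ⟨δ, hδ, h⟩ := hequi ε hε
    exact le_iSup₂_of_le δ hδ
      (liminf_le_liminf (.of_forall fun n => localEntRate_map_le hp hcomm μ h n x))
  · refine eInt_map_le (fun y => (h_nonneg y).trans (localLowerEnt_le_localUpperEnt _ _ y))
      fun x => iSup₂_le fun ε hε => ?_
    obtain ⟨δ, hδ, h⟩ := hequi ε hε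
    exact le_iSup₂_of_le δ hδ
      (limsup_le_limsup (.of_forall fun n => localEntRate_map_le hp hcomm μ h n x))

end LocalEntropy

end NDS

open NDS in
/-- Invariance of measure-theoretic entropies.
Let `π` be a semiconjugacy from `(X,T)` to `(Y,R)`, `μ` a Borel probability
measure on `X 0` and `ν = (π₀)_*μ`.  (1) If `π` is an equisemiconjugacy then
`h̲_μ(T) ≥ h̲_ν(R)` and `h̄_μ(T) ≥ h̄_ν(R)`.  (2) If `π` is an equiconjugacy
(each `π_k` bijective with equicontinuous inverses) then these are equalities. -/
theorem stmt16 {X Y : ℕ → Type*}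
    [∀ k, MetricSpace (X k)] [∀ k, CompactSpace (X k)]
    [∀ k, MetricSpace (Y k)] [∀ k, CompactSpace (Y k)]
    [MeasurableSpace (X 0)] [BorelSpace (X 0)]
    [MeasurableSpace (Y 0)] [BorelSpace (Y 0)]
    (T : ∀ k, X k → X (k + 1)) (hT : ∀ k, Continuous (T k))
    (R : ∀ k, Y k → Y (k + 1)) (hR : ∀ k, Continuous (R k))
    (π : ∀ k, X k → Y k) (hπc : ∀ k, Continuous (π k))
    (hπs : ∀ k, Function.Surjective (π k))
    (hcomm : ∀ k (x : X k), R k (π k x) = π (k + 1) (T k x))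
    (μ : MeasureTheory.Measure (X 0)) [MeasureTheory.IsProbabilityMeasure μ] :
    ((∀ ε : ℝ, 0 < ε → ∃ δ : ℝ, 0 < δ ∧
        ∀ k (x y : X k), dist x y < δ → dist (π k x) (π k y) < ε) →
      lowerEnt (μ.map (π 0)) R ≤ lowerEnt μ T ∧
        upperEnt (μ.map (π 0)) R ≤ upperEnt μ T) ∧
    ((∀ ε : ℝ, 0 < ε → ∃ δ : ℝ, 0 < δ ∧
        ∀ k (x y : X k), dist x y < δ → dist (π k x) (π k y) < ε) →
      (∀ k, Function.Bijective (π k)) →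
      (∀ ε : ℝ, 0 < ε → ∃ δ : ℝ, 0 < δ ∧
        ∀ k (x y : X k), dist (π k x) (π k y) < δ → dist x y < ε) →
      lowerEnt (μ.map (π 0)) R = lowerEnt μ T ∧
        upperEnt (μ.map (π 0)) R = upperEnt μ T) := by
  refine ⟨entropy_map_le (hπc 0).measurable hcomm μ, fun hequi hbij hequi_inv => ?_⟩
  let e : ∀ k, X k ≃ Y k := fun k => Equiv.ofBijective (π k) (hbij k)
  have he : ∀ k y, π k ((e k).symm y) = y := fun k => (e k).apply_symm_apply
  have hequi_symm : ∀ ε : ℝ, 0 < ε → ∃ δ : ℝ, 0 < δ ∧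
      ∀ k (x y : Y k), dist x y < δ → dist ((e k).symm x) ((e k).symm y) < ε := by
    intro ε hε
    obtain ⟨δ, hδ, h⟩ := hequi_inv ε hε
    exact ⟨δ, hδ, fun k x y hxy => h k _ _ (by rwa [he, he])⟩
  have hcont : Continuous (e 0).symm := Metric.continuous_iff.2 fun y ε hε => by
    obtain ⟨δ, hδ, h⟩ := hequi_symm ε hε
    exact ⟨δ, hδ, fun x hx => h 0 x y hx⟩
  have hcomm_symm : ∀ k (y : Y k), T k ((e k).symm y) = (e (k + 1)).symm (R k y) := fun k y =>
    (hbij (k + 1)).1 (by rw [he, ← hcomm, he])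
  have hmap : (μ.map (π 0)).map (e 0).symm = μ := by
    rw [Measure.map_map hcont.measurable (hπc 0).measurable]
    have hid : (e 0).symm ∘ π 0 = id := funext (e 0).symm_apply_apply
    rw [hid, Measure.map_id]
  have : IsProbabilityMeasure (μ.map (π 0)) :=
    Measure.isProbabilityMeasure_map (hπc 0).measurable.aemeasurable
  have hle := entropy_map_le (hπc 0).measurable hcomm μ hequi
  have hge := entropy_map_le (p := fun k => (e k).symm) hcont.measurable hcomm_symm
    (μ.map (π 0)) hequi_symm
  rw [hmap] at hge
  exact ⟨le_antisymm hle.1 hge.1, le_antisymm hle.2 hge.2⟩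
end

section
/- Let (X,T) be a nonautonomous dynamical system, E ⊂ X_0 a non-empty Borel set, μ a Borel probability measure on X_0 with μ(E) = 1, and f = (f_k) an equicontinuous sequence of continuous real-valued potentials. Then the measure-theoretic lower pressure is bounded by the Bowen pressure of E: P̲_μ(T,f) ≤ P^B(T,f,E). -/
open Filter MeasureTheory Set
open scoped ENNReal Topology

namespace NDS

lemma eInt_le_of_ae_le {α : Type*} [MeasurableSpace α] (μ : Measure α) [IsProbabilityMeasure μ]
    {g : α → EReal} {s : ℝ} (h : ∀ᵐ x ∂μ, g x ≤ (s : EReal)) : eInt μ g ≤ (s : EReal) := by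
  have toENN_mono : Monotone toENN := by
    intro a b hab
    induction a <;> induction b <;> simp_all [toENN]
    exact ENNReal.ofReal_le_ofReal hab
  have ofENN_mono : Monotone ofENN := by
    intro a b hab
    unfold ofENN
    by_cases hb : b = ⊤
    · simp [hb]
    · have ha : a ≠ ⊤ := ne_top_of_le_ne_top hb hab
      simpa [ha, hb] using ENNReal.toReal_mono hb hab
  have hpos : ∫⁻ x, toENN (g x) ∂μ ≤ toENN s := by
    refine (lintegral_mono_ae (h.mono fun x hx => toENN_mono hx)).trans ?_
    simp
  have hneg : toENN (-s : EReal) ≤ ∫⁻ x, toENN (-g x) ∂μ := by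
    refine le_trans ?_ (lintegral_mono_ae
      (h.mono fun x hx => toENN_mono (EReal.neg_le_neg_iff.mpr hx)))
    simp
  refine (EReal.sub_le_sub (ofENN_mono hpos) (ofENN_mono hneg)).trans (le_of_eq ?_)
  rw [← EReal.coe_neg]
  simp only [toENN, EReal.coe_ne_top, if_false, EReal.toReal_coe, ofENN, ENNReal.ofReal_ne_top]
  rw [← EReal.coe_sub, ENNReal.toReal_ofReal', ENNReal.toReal_ofReal']
  norm_cast
  rcases le_total 0 s with hs | hs
  · rw [max_eq_left hs, max_eq_right (by linarith)]; ring
  · rw [max_eq_right hs, max_eq_left (by linarith)]; ring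

variable {X : ℕ → Type*}

lemma le_ofReal_exp_of_lt_inv_mul {m : ℝ≥0∞} (hm : m ≠ ⊤) {n : ℕ} (hn : 0 < n) {s b : ℝ}
    (h : (s : EReal) < (((n : ℝ)⁻¹ : ℝ) : EReal) * (-(elog m) + (b : EReal))) :
    m ≤ ENNReal.ofReal (Real.exp (-(n : ℝ) * s + b)) := by
  by_cases h0 : m = 0
  · simp [h0]
  simp only [elog, h0, hm, if_false] at h
  norm_cast at h
  have hn' : (0 : ℝ) < n := by exact_mod_cast hn
  rw [inv_mul_eq_div, lt_div_iff₀ hn'] at h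
  rw [ENNReal.le_ofReal_iff_toReal_le hm (Real.exp_pos _).le,
    ← Real.log_le_iff_le_exp (ENNReal.toReal_pos h0 hm)]
  linarith

variable [∀ k, MetricSpace (X k)]

lemma bowenBall_mono (T : ∀ k, X k → X (k + 1)) (n : ℕ) {ε ε' : ℝ} (h : ε ≤ ε') (x : X 0) :
    bowenBall T n ε x ⊆ bowenBall T n ε' x :=
  fun _ hy j hj => (hy j hj).trans_le h

lemma bowenBall_subset_of_mem (T : ∀ k, X k → X (k + 1)) {n : ℕ} {ε : ℝ} {x y : X 0}
    (hy : y ∈ bowenBall T n (ε / 2) x) : bowenBall T n (ε / 2) x ⊆ bowenBall T n ε y := by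
  intro z hz j hj
  have h1 := hy j hj
  have h2 := hz j hj
  have h3 := dist_triangle_left (iter T j y) (iter T j z) (iter T j x)
  linarith

lemma birk_sub_le (T : ∀ k, X k → X (k + 1)) {f : ∀ k, X k → ℝ} {η δ : ℝ}
    (h : ∀ k, ∀ x y : X k, dist x y < δ → |f k x - f k y| < η) {n : ℕ} {x y : X 0}
    (hy : y ∈ bowenBall T n δ x) : birk T f n y - birk T f n x ≤ n * η := by
  unfold birk
  rw [← Finset.sum_sub_distrib]
  refine (Finset.sum_le_card_nsmul _ _ η fun j hj => ?_).trans (by simp)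
  have := h j _ _ (hy j (Finset.mem_range.mp hj))
  linarith [neg_abs_le (f j (iter T j x) - f j (iter T j y))]

/-- A mass distribution principle for the Bowen pressure. -/
lemma measure_eq_zero_of_bowenP_lt [MeasurableSpace (X 0)] (T : ∀ k, X k → X (k + 1))
    {f : ∀ k, X k → ℝ} (hfe : EquicontPotential f) (μ : Measure (X 0)) {A E : Set (X 0)}
    (hAE : A ⊆ E) {s t ε : ℝ} (hε : 0 < ε) {N : ℕ}
    (hA : ∀ x ∈ A, ∀ n ≥ N,
      μ (bowenBall T n ε x) ≤ ENNReal.ofReal (Real.exp (-(n : ℝ) * s + birk T f n x)))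
    (hts : t < s) (hP : bowenP T f E < (t : EReal)) : μ A = 0 := by
  obtain ⟨δ, hδ, hδf⟩ := hfe (s - t) (by linarith)
  have hr : 0 < min δ (ε / 2) := lt_min hδ (by linarith)
  have hcrit : bowenCrit T f (min δ (ε / 2)) E < (t : EReal) :=
    (le_iSup₂ (f := fun (ε : ℝ) (_ : 0 < ε) => bowenCrit T f ε E) _ hr).trans_lt hP
  simp only [bowenCrit, iInf_lt_iff] at hcrit
  obtain ⟨u, hu, hut⟩ := hcrit
  have hut' : u < t := by exact_mod_cast hut
  rw [← nonpos_iff_eq_zero, ← hu]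
  refine le_trans ?_ (le_iSup (fun N => bowenPre T f u N (min δ (ε / 2)) E) N)
  refine le_iInf fun D => le_iInf fun hDc => le_iInf fun hDN => le_iInf fun hDE => ?_
  have : Countable D := hDc.to_subtype
  have hcov : A ⊆ ⋃ p : D, A ∩ bowenBall T p.1.2 (min δ (ε / 2)) p.1.1 := by
    intro x hx
    obtain ⟨p, hp, hxp⟩ := mem_iUnion₂.mp (hDE (hAE hx))
    exact mem_iUnion.mpr ⟨⟨p, hp⟩, hx, hxp⟩
  refine (measure_mono hcov).trans ((measure_iUnion_le _).trans (ENNReal.tsum_le_tsum ?_))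
  rintro ⟨⟨x, n⟩, hp⟩
  rcases (A ∩ bowenBall T n (min δ (ε / 2)) x).eq_empty_or_nonempty with he | ⟨y, hyA, hy⟩
  · simp [he]
  have hsub : bowenBall T n (min δ (ε / 2)) x ⊆ bowenBall T n ε y :=
    (bowenBall_mono T n (min_le_right _ _) x).trans
      (bowenBall_subset_of_mem T (bowenBall_mono T n (min_le_right _ _) x hy))
  refine (measure_mono (inter_subset_right.trans hsub)).trans ((hA y hyA n (hDN _ hp)).trans ?_)
  have hb := birk_sub_le T hδf (bowenBall_mono T n (min_le_left _ _) x hy)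
  have hnu : (n : ℝ) * u ≤ n * t := by gcongr
  refine ENNReal.ofReal_le_ofReal (Real.exp_le_exp.mpr ?_)
  simp only
  linarith

/-- If the local lower pressure exceeds `s`, the measures of the Bowen balls of radius
`1 / (m + 1)` eventually decay exponentially at the corresponding rate. -/
lemma exists_measure_bowenBall_le [MeasurableSpace (X 0)] (T : ∀ k, X k → X (k + 1))
    (f : ∀ k, X k → ℝ) (μ : Measure (X 0)) [IsFiniteMeasure μ] {s : ℝ} {x : X 0}
    (hx : (s : EReal) < localLowerPres μ T f x) :
    ∃ m N : ℕ, ∀ n ≥ N, μ (bowenBall T n (1 / ((m : ℝ) + 1)) x) ≤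
      ENNReal.ofReal (Real.exp (-(n : ℝ) * s + birk T f n x)) := by
  simp only [localLowerPres, lt_iSup_iff] at hx
  obtain ⟨ε, hε, hx⟩ := hx
  obtain ⟨m, hm⟩ := exists_nat_one_div_lt hε
  obtain ⟨N, hN⟩ := eventually_atTop.mp
    ((eventually_lt_of_lt_liminf hx).and (eventually_gt_atTop 0))
  refine ⟨m, N, fun n hn => (measure_mono (bowenBall_mono T n hm.le x)).trans ?_⟩
  exact le_ofReal_exp_of_lt_inv_mul (measure_ne_top μ _) (hN n hn).2 (hN n hn).1

lemma ae_localLowerPres_le [MeasurableSpace (X 0)] (T : ∀ k, X k → X (k + 1))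
    {f : ∀ k, X k → ℝ} (hfe : EquicontPotential f) (μ : Measure (X 0)) [IsFiniteMeasure μ]
    {E : Set (X 0)} (hE : ∀ᵐ x ∂μ, x ∈ E) {s t : ℝ} (hts : t < s)
    (hP : bowenP T f E < (t : EReal)) :
    ∀ᵐ x ∂μ, localLowerPres μ T f x ≤ (s : EReal) := by
  have hnull : ∀ m N : ℕ, ∀ᵐ x ∂μ, x ∉ {x | x ∈ E ∧ ∀ n ≥ N,
      μ (bowenBall T n (1 / ((m : ℝ) + 1)) x) ≤
        ENNReal.ofReal (Real.exp (-(n : ℝ) * s + birk T f n x))} := fun m N =>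
    measure_eq_zero_iff_ae_notMem.mp (measure_eq_zero_of_bowenP_lt T hfe μ (fun _ hx => hx.1)
      Nat.one_div_pos_of_nat (fun _ hx => hx.2) hts hP)
  filter_upwards [hE, ae_all_iff.mpr fun m => ae_all_iff.mpr (hnull m)] with x hxE hx
  by_contra! hlt
  obtain ⟨m, N, hmN⟩ := exists_measure_bowenBall_le T f μ hlt
  exact hx m N ⟨hxE, hmN⟩

end NDS

open NDS in
/-- Variational inequality for the Bowen pressure.
If `E` is a non-empty Borel subset of `X 0`, `μ` a Borel probability measure with
`μ(E) = 1`, and `f` equicontinuous, then `P̲_μ(T,f) ≤ P^B(T,f,E)`. -/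
theorem stmt17 {X : ℕ → Type*} [∀ k, MetricSpace (X k)] [∀ k, CompactSpace (X k)]
    [MeasurableSpace (X 0)] [BorelSpace (X 0)]
    (T : ∀ k, X k → X (k + 1)) (hT : ∀ k, Continuous (T k))
    (f : ∀ k, X k → ℝ) (hf : ∀ k, Continuous (f k)) (hfe : EquicontPotential f)
    (E : Set (X 0)) (hEne : E.Nonempty) (hE : MeasurableSet E)
    (μ : MeasureTheory.Measure (X 0)) [MeasureTheory.IsProbabilityMeasure μ]
    (hμE : μ E = 1) :
    lowerPres μ T f ≤ bowenP T f E := by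
  by_contra! hlt
  obtain ⟨t, hPt, ht⟩ := EReal.lt_iff_exists_real_btwn.mp hlt
  obtain ⟨s, hts, hs⟩ := EReal.lt_iff_exists_real_btwn.mp ht
  have hE' : ∀ᵐ x ∂μ, x ∈ E := mem_ae_iff_prob_eq_one hE |>.mpr hμE
  exact hs.not_ge (eInt_le_of_ae_le μ
    (ae_localLowerPres_le T hfe μ hE' (by exact_mod_cast hts) hPt))
end

section
/- Let (X,T) be a nonautonomous dynamical system, f = (f_k) a uniformly bounded sequence of continuous real-valued potentials (‖f‖ = sup_k ‖f_k‖_∞ < +∞), Z ⊂ X_0, ε > 0, and s > ‖f‖. Assume that P^s_{∞,ε}(T,f,Z) = +∞. Then for all real numbers a, b with 0 ≤ a < b < +∞ and every M > 0, there exists a finite pairwise disjoint collection {B̄_{m_i}^T(x_i,ε)}_{i∈I} of closed Bowen balls with x_i ∈ Z and m_i > M for all i ∈ I, such that a < Σ_{i∈I} exp(−m_i s + S_{m_i}^T f(x_i)) < b. -/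
open Filter MeasureTheory Set
open scoped ENNReal Topology

/-- If every term is nonnegative and smaller than `b - a` and the total exceeds `a ≥ 0`, some
subsum lies strictly between `a` and `b`. -/
lemma Finset.exists_subset_sum_mem_Ioo {ι : Type*} {w : ι → ℝ} {a b : ℝ}
    (ha : 0 ≤ a) (F : Finset ι) (hw : ∀ i ∈ F, w i < b - a) (hF : a < ∑ i ∈ F, w i) :
    ∃ I ⊆ F, a < ∑ i ∈ I, w i ∧ ∑ i ∈ I, w i < b := by
  classical
  induction F using Finset.induction_on with
  | empty => exact absurd hF (by simpa using ha)
  | insert i F hi ih =>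
    by_cases h : a < ∑ j ∈ F, w j
    · obtain ⟨I, hI, h'⟩ := ih (fun j hj => hw j (Finset.mem_insert_of_mem hj)) h
      exact ⟨I, hI.trans (Finset.subset_insert i F), h'⟩
    · refine ⟨insert i F, subset_rfl, hF, ?_⟩
      have := hw i (Finset.mem_insert_self i F)
      rw [Finset.sum_insert hi]
      linarith

/-- For a uniformly bounded sequence of potentials, every value is bounded by `‖f‖`. -/
lemma NDS.abs_le_fnorm {X : ℕ → Type*} {f : ∀ k, X k → ℝ}
    (hbdd : ∃ C : ℝ, ∀ k (x : X k), |f k x| ≤ C) (k : ℕ) (x : X k) : |f k x| ≤ NDS.fnorm f := by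
  obtain ⟨C, hC⟩ := hbdd
  have h₁ : |f k x| ≤ ⨆ y : X k, |f k y| :=
    le_ciSup (f := fun y : X k => |f k y|) ⟨C, by rintro _ ⟨y, rfl⟩; exact hC k y⟩ x
  refine h₁.trans (le_ciSup (f := fun j : ℕ => ⨆ y : X j, |f j y|) ⟨max C 0, ?_⟩ k)
  rintro _ ⟨j, rfl⟩
  exact Real.iSup_le (fun y => (hC j y).trans (le_max_left _ _)) (le_max_right _ _)

/-- For a uniformly bounded sequence of potentials, `S_n^T f ≤ n ‖f‖`. -/
lemma NDS.birk_le_mul_fnorm {X : ℕ → Type*} (T : ∀ k, X k → X (k + 1)) {f : ∀ k, X k → ℝ}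
    (hbdd : ∃ C : ℝ, ∀ k (x : X k), |f k x| ≤ C) (n : ℕ) (x : X 0) :
    NDS.birk T f n x ≤ n * NDS.fnorm f := by
  simpa [NDS.birk] using Finset.sum_le_card_nsmul (Finset.range n) (fun j => f j (NDS.iter T j x))
    (NDS.fnorm f) fun j _ => (le_abs_self _).trans (NDS.abs_le_fnorm hbdd j _)

/-- If the packing premeasure `P^s_{N,ε}(T,f,Z)` is infinite, then finite packings have
arbitrarily large weighted sums. -/
lemma NDS.exists_finset_lt_sum_of_packPre_eq_top {X : ℕ → Type*} [∀ k, MetricSpace (X k)]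
    {T : ∀ k, X k → X (k + 1)} {f : ∀ k, X k → ℝ} {s : ℝ} {N : ℕ} {ε : ℝ} {Z : Set (X 0)}
    (h : NDS.packPre T f s N ε Z = ⊤) {a : ℝ} (ha : 0 ≤ a) :
    ∃ F : Finset (X 0 × ℕ), NDS.IsPacking T N ε Z F ∧
      a < ∑ p ∈ F, Real.exp (-(p.2 : ℝ) * s + NDS.birk T f p.2 p.1) := by
  have hlt : ENNReal.ofReal a < NDS.packPre T f s N ε Z := h ▸ ENNReal.ofReal_lt_top
  obtain ⟨D, hD⟩ := lt_iSup_iff.mp hlt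
  obtain ⟨⟨-, hmem, hdisj⟩, hD⟩ := lt_iSup_iff.mp hD
  rw [ENNReal.tsum_eq_iSup_sum] at hD
  obtain ⟨G, hG⟩ := lt_iSup_iff.mp hD
  have hsub : ∀ p ∈ G.map (Function.Embedding.subtype _), p ∈ D := by
    intro p hp
    obtain ⟨q, -, rfl⟩ := Finset.mem_map.mp hp
    exact q.2
  refine ⟨G.map (Function.Embedding.subtype _), ⟨Finset.countable_toSet _,
    fun p hp => hmem p (hsub p hp),
    fun p hp q hq => hdisj p (hsub p hp) q (hsub q hq)⟩, ?_⟩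
  rw [← ENNReal.ofReal_sum_of_nonneg fun _ _ => (Real.exp_pos _).le] at hG
  simpa using (ENNReal.ofReal_lt_ofReal_iff_of_nonneg ha).mp hG

open NDS in
/-- Extraction lemma for packings.
Let `f` be uniformly bounded (`‖f‖ < ∞`), `s > ‖f‖`, and suppose
`P^s_{∞,ε}(T,f,Z) = ∞`.  Then for all `0 ≤ a < b < ∞` and every `M > 0` there is a
finite pairwise disjoint collection of closed Bowen balls `B̄_{m_i}^T(x_i,ε)` with
`x_i ∈ Z`, `m_i > M`, whose weighted sum `∑ exp(-m_i s + S_{m_i}^T f(x_i))` lies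
strictly between `a` and `b`. -/
theorem stmt19 {X : ℕ → Type*} [∀ k, MetricSpace (X k)] [∀ k, CompactSpace (X k)]
    (T : ∀ k, X k → X (k + 1)) (hT : ∀ k, Continuous (T k))
    (f : ∀ k, X k → ℝ) (hf : ∀ k, Continuous (f k))
    (hbdd : ∃ C : ℝ, ∀ k (x : X k), |f k x| ≤ C)
    (Z : Set (X 0)) (ε : ℝ) (hε : 0 < ε)
    (s : ℝ) (hs : fnorm f < s)
    (hinf : packPreInf T f s ε Z = ⊤) :
    ∀ a b : ℝ, 0 ≤ a → a < b → ∀ M : ℕ, 0 < M →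
      ∃ I : Finset (X 0 × ℕ),
        (∀ p ∈ I, p.1 ∈ Z ∧ M < p.2) ∧
        (∀ p ∈ I, ∀ q ∈ I, p ≠ q →
          Disjoint (bowenClosedBall T p.2 ε p.1) (bowenClosedBall T q.2 ε q.1)) ∧
        a < ∑ p ∈ I, Real.exp (-(p.2 : ℝ) * s + birk T f p.2 p.1) ∧
        ∑ p ∈ I, Real.exp (-(p.2 : ℝ) * s + birk T f p.2 p.1) < b := by
  intro a b ha hab M _
  have hpos : 0 < s - fnorm f := sub_pos.mpr hs
  have hlim : Tendsto (fun n : ℕ => Real.exp (-((n : ℝ) * (s - fnorm f)))) atTop (𝓝 0) :=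
    Real.tendsto_exp_neg_atTop_nhds_zero.comp
      (tendsto_natCast_atTop_atTop.atTop_mul_const hpos)
  obtain ⟨N, hMN, hN⟩ :=
    ((eventually_gt_atTop M).and (hlim.eventually_lt_const (sub_pos.mpr hab))).exists
  obtain ⟨F, ⟨-, hmem, hdisj⟩, hF⟩ :=
    exists_finset_lt_sum_of_packPre_eq_top (iInf_eq_top.mp hinf N) ha
  obtain ⟨I, hIF, hI⟩ := Finset.exists_subset_sum_mem_Ioo ha F (b := b) (fun p hp => by
    refine lt_of_le_of_lt (Real.exp_le_exp.mpr ?_) hN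
    have hNp : (N : ℝ) ≤ p.2 := by exact_mod_cast (hmem p hp).2
    have := birk_le_mul_fnorm T hbdd p.2 p.1
    nlinarith) hF
  exact ⟨I, fun p hp => ⟨(hmem p (hIF hp)).1, hMN.trans_le (hmem p (hIF hp)).2⟩,
    fun p hp q hq => hdisj p (hIF hp) q (hIF hq), hI⟩
end
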